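/- arXiv:2205.15376 — 8 statements merged into one kernel-verified Lean document; each statement's English description precedes it below -/
import Mathlib

section
/- Let n be a positive integer. Then B·M = I and M·B = I, where I is the n×n identity matrix; in particular B is invertible with B⁻¹ = M. -/
open Matrix BigOperators

/-- The action of the tridiagonal second-difference matrix on a sequence vanishing at `n`. -/
theorem sum_tridiagonal_mul {R : Type*} [CommRing R] {n i : ℕ} (hi : i < n) (f : ℕ → R)
    (hf : f n = 0) :
    ∑ k ∈ Finset.range n, (if i = k then (if i = 0 then 1 else 2)
      else if i + 1 = k ∨ k + 1 = i then -1 else 0) * f k =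
    (if i = 0 then f i else 2 * f i - f (i - 1)) - f (i + 1) := by
  have split_term (k : ℕ) : (if i = k then (if i = 0 then 1 else 2)
      else if i + 1 = k ∨ k + 1 = i then -1 else 0) * f k =
      (if i = k then (if i = 0 then 1 else 2) * f k else 0) - (if i + 1 = k then f k else 0)
        - (if i - 1 = k then (if i = 0 then 0 else f k) else 0) := by
    split_ifs <;> first | omega | ring
  have boundary : (if i + 1 < n then f (i + 1) else 0) = f (i + 1) := by
    split_ifs with h
    · rfl
    · rw [show i + 1 = n by omega, hf]
  simp only [split_term, Finset.sum_sub_distrib, Finset.sum_ite_eq, Finset.mem_range, boundary,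
    if_pos hi, if_pos (show i - 1 < n by omega)]
  split_ifs <;> ring

/-- For a positive integer `n`, let `B` be the `n×n` real matrix with
entries `B(i,j) = n + 1 - max(i,j)` (1-indexed), and `M` the symmetric tridiagonal matrix
with `M(1,1) = 1`, `M(i,i) = 2` for `i ≥ 2`, `M(i,i±1) = -1`, and `0` elsewhere.
Then `B * M = 1` and `M * B = 1`; in particular `B` is invertible with `B⁻¹ = M`. -/
theorem tridiagonal_inverse_of_max_matrix (n : ℕ) (hn : 0 < n)
    (B M : Matrix (Fin n) (Fin n) ℝ)
    (hB : ∀ i j : Fin n,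
      B i j = (n : ℝ) + 1 - ((max ((i : ℕ) + 1) ((j : ℕ) + 1) : ℕ) : ℝ))
    (hM : ∀ i j : Fin n,
      M i j = if i = j then (if (i : ℕ) = 0 then 1 else 2)
        else if (i : ℕ) + 1 = (j : ℕ) ∨ (j : ℕ) + 1 = (i : ℕ) then -1 else 0) :
    B * M = 1 ∧ M * B = 1 ∧ IsUnit B ∧ B⁻¹ = M := by
  have hMB : M * B = 1 := by
    ext i j
    have hterm (k : Fin n) : B k j = (n : ℝ) - (max (k : ℕ) (j : ℕ) : ℕ) := by
      rw [hB, max_add_add_right]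
      push_cast
      ring
    have hsum := sum_tridiagonal_mul i.isLt (fun k => (n : ℝ) - (max k (j : ℕ) : ℕ))
      (by simp [j.isLt.le])
    rw [Finset.sum_range] at hsum
    simp only [mul_apply, hM, hterm, Fin.ext_iff, one_apply]
    rw [hsum]
    rcases lt_trichotomy (i : ℕ) j with h | h | h
    · rw [max_eq_right h.le, max_eq_right (by omega : (i : ℕ) - 1 ≤ j),
        max_eq_right (by omega : (i : ℕ) + 1 ≤ j), if_neg h.ne]
      split_ifs <;> ring
    · rw [max_eq_left h.ge, max_eq_right (by omega : (i : ℕ) - 1 ≤ j),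
        max_eq_left (by omega : (j : ℕ) ≤ i + 1), if_pos h, ← h]
      split_ifs <;> push_cast <;> ring
    · rw [max_eq_left h.le, max_eq_left (by omega : (j : ℕ) ≤ i - 1),
        max_eq_left (by omega : (j : ℕ) ≤ i + 1), if_neg h.ne', if_neg (by omega),
        Nat.cast_sub (by omega : 1 ≤ (i : ℕ))]
      push_cast
      ring
  have hBM : B * M = 1 := mul_eq_one_comm.mp hMB
  exact ⟨hBM, hMB, IsUnit.of_mul_eq_one M hBM, inv_eq_right_inv hBM⟩
end

section
/- Let n be a positive integer. Then B - (1/4)·I is positive semidefinite; that is, for every x ∈ ℝ^n, xᵀ B x ≥ (1/4)‖x‖₂², so the smallest eigenvalue of B is at least 1/4. -/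
open Matrix BigOperators

theorem sum_sum_mul_sub_max_eq_sum_sq (y : ℕ → ℝ) (n : ℕ) :
    ∑ i ∈ Finset.range n, ∑ j ∈ Finset.range n, y i * y j * ((n : ℝ) - (max i j : ℕ)) =
      ∑ k ∈ Finset.range n, (∑ i ∈ Finset.range (k + 1), y i) ^ 2 := by
  induction n with
  | zero => simp
  | succ n ih =>
    have hsplit : ∑ i ∈ Finset.range (n + 1), ∑ j ∈ Finset.range (n + 1),
        y i * y j * (((n + 1 : ℕ) : ℝ) - (max i j : ℕ)) =
        ∑ i ∈ Finset.range (n + 1), ∑ j ∈ Finset.range (n + 1),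
          y i * y j * ((n : ℝ) - (max i j : ℕ)) +
        (∑ i ∈ Finset.range (n + 1), y i) ^ 2 := by
      rw [sq, Finset.sum_mul_sum, ← Finset.sum_add_distrib]
      refine Finset.sum_congr rfl fun i _ => ?_
      rw [← Finset.sum_add_distrib]
      refine Finset.sum_congr rfl fun j _ => ?_
      push_cast
      ring
    have hlast : ∑ j ∈ Finset.range (n + 1), y n * y j * ((n : ℝ) - (max n j : ℕ)) = 0 := by
      refine Finset.sum_eq_zero fun j hj => ?_
      rw [max_eq_left (Nat.lt_succ_iff.mp (Finset.mem_range.mp hj)), sub_self, mul_zero]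
    rw [hsplit, Finset.sum_range_succ _ n, hlast, add_zero,
      Finset.sum_range_succ (fun k => (∑ i ∈ Finset.range (k + 1), y i) ^ 2) n, ← ih]
    congr 1
    refine Finset.sum_congr rfl fun i hi => ?_
    rw [Finset.sum_range_succ, max_eq_right (Finset.mem_range.mp hi).le, sub_self, mul_zero,
      add_zero]

theorem sum_sq_add_le_four_mul_sum_sq_partialSum (y : ℕ → ℝ) (n : ℕ) :
    ∑ k ∈ Finset.range n, y k ^ 2 + 2 * (∑ i ∈ Finset.range n, y i) ^ 2 ≤
      4 * ∑ k ∈ Finset.range n, (∑ i ∈ Finset.range (k + 1), y i) ^ 2 := by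
  induction n with
  | zero => simp
  | succ n ih =>
    rw [Finset.sum_range_succ (fun k => y k ^ 2),
      Finset.sum_range_succ (fun k => (∑ i ∈ Finset.range (k + 1), y i) ^ 2),
      Finset.sum_range_succ y]
    nlinarith [sq_nonneg (2 * (∑ i ∈ Finset.range n, y i) + y n)]

theorem quarter_mul_sum_sq_le_sum_sum_sub_max (n : ℕ) (x : Fin n → ℝ) :
    (1 / 4 : ℝ) * ∑ i, x i ^ 2 ≤
      ∑ i, ∑ j, x i * x j * ((n : ℝ) - (max (i : ℕ) (j : ℕ) : ℕ)) := by
  obtain ⟨y, rfl⟩ : ∃ y : ℕ → ℝ, x = fun i : Fin n => y i :=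
    ⟨fun k => if h : k < n then x ⟨k, h⟩ else 0, by ext i; simp⟩
  have hform := sum_sum_mul_sub_max_eq_sum_sq y n
  have hle := sum_sq_add_le_four_mul_sum_sq_partialSum y n
  rw [← hform] at hle
  simp only [Finset.sum_range] at hle
  nlinarith [sq_nonneg (∑ i : Fin n, y i)]

/-- For the `n×n` real matrix `B` with entries
`B(i,j) = n + 1 - max(i,j)` (1-indexed), the matrix `B - (1/4)·I` is positive
semidefinite; that is, `xᵀ B x ≥ (1/4)‖x‖₂²` for every `x ∈ ℝ^n`, so the smallest
eigenvalue of `B` is at least `1/4`. -/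
theorem max_matrix_quadratic_form_ge_quarter (n : ℕ) (hn : 0 < n)
    (B : Matrix (Fin n) (Fin n) ℝ)
    (hB : ∀ i j : Fin n,
      B i j = (n : ℝ) + 1 - ((max ((i : ℕ) + 1) ((j : ℕ) + 1) : ℕ) : ℝ)) :
    (B - (1 / 4 : ℝ) • (1 : Matrix (Fin n) (Fin n) ℝ)).PosSemidef ∧
    (∀ x : Fin n → ℝ, (1 / 4 : ℝ) * (x ⬝ᵥ x) ≤ x ⬝ᵥ (B *ᵥ x)) ∧
    (∀ μ : ℝ, Module.End.HasEigenvalue (Matrix.toLin' B) μ → (1 / 4 : ℝ) ≤ μ) := by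
  have hquad : ∀ x : Fin n → ℝ, (1 / 4 : ℝ) * (x ⬝ᵥ x) ≤ x ⬝ᵥ (B *ᵥ x) := by
    intro x
    convert quarter_mul_sum_sq_le_sum_sum_sub_max n x using 1
    · simp only [dotProduct, sq]
    · simp only [dotProduct, mulVec, Finset.mul_sum]
      refine Finset.sum_congr rfl fun i _ => Finset.sum_congr rfl fun j _ => ?_
      rw [hB, max_add_add_right]
      push_cast
      ring
  have hsymm : B.IsHermitian := by
    ext i j
    simp [hB, max_comm]
  refine ⟨.of_dotProduct_mulVec_nonneg ?_ fun x => ?_, hquad, fun μ hμ => ?_⟩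
  · refine hsymm.sub ?_
    simp [IsHermitian]
  · simpa [sub_mulVec, smul_mulVec, dotProduct_sub] using hquad x
  · obtain ⟨v, hv⟩ := hμ.exists_hasEigenvector
    have hBv : B *ᵥ v = μ • v := by simpa using hv.apply_eq_smul
    have hpos : 0 < v ⬝ᵥ v := by simpa using dotProduct_star_self_pos_iff.mpr hv.2
    have hle := hquad v
    rw [hBv, dotProduct_smul, smul_eq_mul] at hle
    exact le_of_mul_le_mul_right hle hpos
end

section
/- Let n be a positive integer and λ ≥ 0 a real number. Then the matrix λI + B is invertible, and for every h ∈ {1,…,n}, the standard basis vector e_h satisfies e_hᵀ (λI + B)⁻¹ e_h ≤ 1/(1/4 + λ). -/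
open Matrix BigOperators

/-- The sum of the entries of `x` whose index is less than `k`. -/
def finPartialSum {n : ℕ} (x : Fin n → ℝ) (k : ℕ) : ℝ :=
  ∑ i : Fin n, if (i : ℕ) < k then x i else 0

lemma finPartialSum_zero {n : ℕ} (x : Fin n → ℝ) : finPartialSum x 0 = 0 := by
  simp [finPartialSum]

lemma finPartialSum_succ_sub {n : ℕ} (x : Fin n → ℝ) (k : Fin n) :
    finPartialSum x (k + 1) - finPartialSum x k = x k := by
  rw [finPartialSum, finPartialSum, ← Finset.sum_sub_distrib, Finset.sum_eq_single k]
  · simp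
  · intro b _ hb
    have : (b : ℕ) ≠ k := fun h => hb (Fin.ext h)
    by_cases h : (b : ℕ) < k
    · simp [h, Nat.lt_succ_of_lt h]
    · have h' : ¬ (b : ℕ) < k + 1 := by omega
      simp [h, h']
  · simp

lemma sum_sq_le_four_mul_sum_sq_finPartialSum {n : ℕ} (x : Fin n → ℝ) :
    ∑ i, x i ^ 2 ≤ 4 * ∑ k : Fin n, finPartialSum x (k + 1) ^ 2 := by
  have shift : ∑ k : Fin n, finPartialSum x k ^ 2 ≤
      ∑ k : Fin n, finPartialSum x (k + 1) ^ 2 := by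
    rw [Fin.sum_univ_eq_sum_range (fun k => finPartialSum x k ^ 2),
      Fin.sum_univ_eq_sum_range (fun k => finPartialSum x (k + 1) ^ 2)]
    have h₁ := Finset.sum_range_succ (fun k => finPartialSum x k ^ 2) n
    have h₂ := Finset.sum_range_succ' (fun k => finPartialSum x k ^ 2) n
    simp only [finPartialSum_zero] at h₂
    nlinarith [sq_nonneg (finPartialSum x n)]
  have diff : ∑ i, x i ^ 2 ≤
      ∑ k : Fin n, (2 * finPartialSum x (k + 1) ^ 2 + 2 * finPartialSum x k ^ 2) := by
    refine Finset.sum_le_sum fun k _ => ?_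
    rw [← finPartialSum_succ_sub x k]
    nlinarith [sq_nonneg (finPartialSum x (k + 1) + finPartialSum x k)]
  rw [Finset.sum_add_distrib, ← Finset.mul_sum, ← Finset.mul_sum] at diff
  linarith

lemma sum_ite_mul_ite_eq_sub_max {n : ℕ} (i j : Fin n) :
    ∑ k : Fin n, ((if i ≤ k then (1 : ℝ) else 0) * if j ≤ k then 1 else 0) =
      (n : ℝ) + 1 - ((max ((i : ℕ) + 1) ((j : ℕ) + 1) : ℕ) : ℝ) := by
  have hprod : ∀ k : Fin n, ((if i ≤ k then (1 : ℝ) else 0) * if j ≤ k then 1 else 0) =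
      if k ∈ Finset.Ici (max i j) then 1 else 0 := fun k => by
    simp [← ite_and, and_comm]
  simp_rw [hprod]
  rw [Finset.sum_ite_mem, Finset.univ_inter, Finset.sum_const, Fin.card_Ici, nsmul_one,
    Nat.cast_sub (max i j).is_lt.le]
  rcases le_total i j with h | h
  · rw [max_eq_right h, max_eq_right (Nat.succ_le_succ h)]
    push_cast
    ring
  · rw [max_eq_left h, max_eq_left (Nat.succ_le_succ h)]
    push_cast
    ring

lemma quarter_dotProduct_self_le {n : ℕ} (B : Matrix (Fin n) (Fin n) ℝ)
    (hB : ∀ i j : Fin n,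
      B i j = (n : ℝ) + 1 - ((max ((i : ℕ) + 1) ((j : ℕ) + 1) : ℕ) : ℝ))
    (x : Fin n → ℝ) : 1 / 4 * (x ⬝ᵥ x) ≤ x ⬝ᵥ (B *ᵥ x) := by
  let U : Matrix (Fin n) (Fin n) ℝ := Matrix.of fun k i => if i ≤ k then 1 else 0
  have hBU : B = Uᵀ * U := by
    ext i j
    rw [hB, ← sum_ite_mul_ite_eq_sub_max]
    rfl
  have hU : ∀ k, (U *ᵥ x) k = finPartialSum x (k + 1) := fun k => by
    simp [U, Matrix.mulVec, dotProduct, finPartialSum]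
  have hquad : x ⬝ᵥ (B *ᵥ x) = ∑ k : Fin n, finPartialSum x (k + 1) ^ 2 := by
    rw [hBU, ← Matrix.mulVec_mulVec, Matrix.dotProduct_mulVec, Matrix.vecMul_transpose]
    simp only [dotProduct, hU, sq]
  have hself : x ⬝ᵥ x = ∑ i, x i ^ 2 := by simp only [dotProduct, sq]
  rw [hquad, hself]
  linarith [sum_sq_le_four_mul_sum_sq_finPartialSum x]

lemma Matrix.isUnit_of_mul_dotProduct_self_le {ι : Type*} [Fintype ι] [DecidableEq ι]
    {M : Matrix ι ι ℝ} {c : ℝ} (hc : 0 < c) (hM : ∀ x, c * (x ⬝ᵥ x) ≤ x ⬝ᵥ (M *ᵥ x)) :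
    IsUnit M := by
  rw [← Matrix.mulVec_injective_iff_isUnit, ← Matrix.coe_mulVecLin,
    injective_iff_map_eq_zero]
  intro x hx
  have h := hM x
  rw [← Matrix.mulVecLin_apply, hx, dotProduct_zero] at h
  have hnonneg : 0 ≤ x ⬝ᵥ x := Finset.sum_nonneg fun i _ => mul_self_nonneg (x i)
  exact dotProduct_self_eq_zero.mp (by nlinarith)

lemma Matrix.single_dotProduct_inv_mulVec_single_le {ι : Type*} [Fintype ι] [DecidableEq ι]
    {M : Matrix ι ι ℝ} {c : ℝ} (hc : 0 < c) (hM : ∀ x, c * (x ⬝ᵥ x) ≤ x ⬝ᵥ (M *ᵥ x))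
    (h : ι) :
    (Pi.single h 1 : ι → ℝ) ⬝ᵥ (M⁻¹ *ᵥ (Pi.single h 1 : ι → ℝ)) ≤ 1 / c := by
  have hdet := (Matrix.isUnit_iff_isUnit_det M).mp (isUnit_of_mul_dotProduct_self_le hc hM)
  have hy := hM (M⁻¹ *ᵥ Pi.single h 1)
  rw [Matrix.mulVec_mulVec, Matrix.mul_nonsing_inv M hdet, Matrix.one_mulVec,
    dotProduct_single_one] at hy
  rw [single_one_dotProduct, le_div_iff₀ hc]
  set y := M⁻¹ *ᵥ (Pi.single h 1 : ι → ℝ)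
  have hsq : y h * y h ≤ y ⬝ᵥ y :=
    Finset.single_le_sum (f := fun i => y i * y i) (fun i _ => mul_self_nonneg (y i))
      (Finset.mem_univ h)
  have hle : c * (y h * y h) ≤ y h := (mul_le_mul_of_nonneg_left hsq hc.le).trans hy
  by_contra! hlt
  have hpos : 0 < y h := pos_of_mul_pos_left (one_pos.trans hlt) hc.le
  nlinarith


open Matrix BigOperators

/-- For the `n×n` real matrix `B` with entries
`B(i,j) = n + 1 - max(i,j)` (1-indexed) and any real `λ ≥ 0`, the matrix `λI + B`
is invertible, and every standard basis vector `e_h` satisfies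
`e_hᵀ (λI + B)⁻¹ e_h ≤ 1/(1/4 + λ)`. -/
theorem inverse_quadratic_form_bound_max_matrix (n : ℕ) (hn : 0 < n)
    (lam : ℝ) (hlam : 0 ≤ lam)
    (B : Matrix (Fin n) (Fin n) ℝ)
    (hB : ∀ i j : Fin n,
      B i j = (n : ℝ) + 1 - ((max ((i : ℕ) + 1) ((j : ℕ) + 1) : ℕ) : ℝ)) :
    IsUnit (lam • (1 : Matrix (Fin n) (Fin n) ℝ) + B) ∧
    ∀ h : Fin n,
      (Pi.single h 1 : Fin n → ℝ) ⬝ᵥ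
          ((lam • (1 : Matrix (Fin n) (Fin n) ℝ) + B)⁻¹ *ᵥ (Pi.single h 1 : Fin n → ℝ))
        ≤ 1 / (1 / 4 + lam) := by
  have hc : 0 < 1 / 4 + lam := by positivity
  have hM : ∀ x : Fin n → ℝ, (1 / 4 + lam) * (x ⬝ᵥ x) ≤
      x ⬝ᵥ ((lam • (1 : Matrix (Fin n) (Fin n) ℝ) + B) *ᵥ x) := fun x => by
    rw [Matrix.add_mulVec, Matrix.smul_mulVec, Matrix.one_mulVec, dotProduct_add,
      dotProduct_smul, smul_eq_mul]
    linarith [quarter_dotProduct_self_le B hB x]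
  exact ⟨Matrix.isUnit_of_mul_dotProduct_self_le hc hM,
    Matrix.single_dotProduct_inv_mulVec_single_le hc hM⟩
end

section
/- The matrix V is invertible, and for every index i ∈ {1,…,N}, the standard basis vector e_i satisfies e_iᵀ V⁻¹ e_i ≤ 4/(n_i + 4λ). -/
open Matrix BigOperators

/-- If `u ≤ v` are `{0,1}`-vectors whose supports differ by one element `i`, then `v = u + e_i`. -/
lemma eq_add_single_of_card_succ {ι : Type*} [Fintype ι] [DecidableEq ι] {u v : ι → ℝ}
    (hu : ∀ j, u j = 0 ∨ u j = 1) (hv : ∀ j, v j = 0 ∨ v j = 1)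
    (huv : ∀ j, u j = 1 → v j = 1)
    (hcard : (Finset.univ.filter (fun j => v j = 1)).card
      = (Finset.univ.filter (fun j => u j = 1)).card + 1)
    {i : ι} (hui : u i ≠ 1) (hvi : v i = 1) : v = u + Pi.single i 1 := by
  have hins : insert i (Finset.univ.filter (fun j => u j = 1))
      = Finset.univ.filter (fun j => v j = 1) := by
    apply Finset.eq_of_subset_of_card_le
    · intro j hj
      simp only [Finset.mem_insert, Finset.mem_filter, Finset.mem_univ, true_and] at hj ⊢
      rcases hj with rfl | hj
      · exact hvi
      · exact huv j hj
    · rw [hcard, Finset.card_insert_of_notMem (by simpa using hui)]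
  funext j
  have hj : (j = i ∨ u j = 1) ↔ v j = 1 := by simpa using Finset.ext_iff.mp hins j
  by_cases hji : j = i
  · subst hji
    simp [hvi, (hu j).resolve_right hui]
  · simp only [Pi.add_apply, Pi.single_apply, hji, if_false, add_zero]
    simp only [hji, false_or] at hj
    rcases hu j with h | h
    · have : v j ≠ 1 := fun h' => by simp [hj.mpr h'] at h
      rw [h, (hv j).resolve_right this]
    · rw [h, hj.mp h]

/-- Along a chain of nested `{0,1}`-vectors with supports of size `1, …, n`, the squares of the
partial sums of `x` control a quarter of the square of each coordinate in the largest support. -/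
lemma sq_div_four_le_sum_sq_dotProduct {ι : Type*} [Fintype ι] {n : ℕ}
    (d : Fin n → ι → ℝ)
    (h01 : ∀ h j, d h j = 0 ∨ d h j = 1)
    (hcard : ∀ h, (Finset.univ.filter (fun j => d h j = 1)).card = (h : ℕ) + 1)
    (hmono : ∀ (h : Fin n) (hlt : (h : ℕ) + 1 < n) (j : ι),
      d h j = 1 → d ⟨(h : ℕ) + 1, hlt⟩ j = 1)
    {i : ι} (hi : ∃ h, d h i = 1) (x : ι → ℝ) :
    x i ^ 2 / 4 ≤ ∑ h, (d h ⬝ᵥ x) ^ 2 := by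
  classical
  have hex : ∃ m, ∃ hm : m < n, d ⟨m, hm⟩ i = 1 := by
    obtain ⟨h, hh⟩ := hi
    exact ⟨h, h.2, hh⟩
  obtain ⟨hm, hmi⟩ := Nat.find_spec hex
  have hmin : ∀ l < Nat.find hex, ∀ hl : l < n, d ⟨l, hl⟩ i ≠ 1 :=
    fun l hl hln h => Nat.find_min hex hl ⟨hln, h⟩
  generalize Nat.find hex = m at hm hmi hmin
  cases m with
  | zero =>
    have heq := eq_add_single_of_card_succ (u := 0) (v := d ⟨0, hm⟩) (i := i)
      (by simp) (h01 _) (by simp) (by simp [hcard]) (by simp) hmi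
    have hle := Finset.single_le_sum (f := fun h => (d h ⬝ᵥ x) ^ 2)
      (fun h _ => sq_nonneg _) (Finset.mem_univ (⟨0, hm⟩ : Fin n))
    simp only [heq, zero_add, single_dotProduct, one_mul] at hle
    linarith [sq_nonneg (x i)]
  | succ m =>
    have hm' : m < n := by omega
    have heq := eq_add_single_of_card_succ (u := d ⟨m, hm'⟩) (v := d ⟨m + 1, hm⟩) (i := i)
      (h01 _) (h01 _) (hmono ⟨m, hm'⟩ hm) (by simp [hcard]) (hmin m (by omega) hm') hmi
    have hdot : d ⟨m + 1, hm⟩ ⬝ᵥ x = d ⟨m, hm'⟩ ⬝ᵥ x + x i := by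
      rw [heq, add_dotProduct, single_dotProduct, one_mul]
    have hle := Finset.add_le_sum (f := fun h => (d h ⬝ᵥ x) ^ 2) (s := Finset.univ)
      (fun h _ => sq_nonneg _) (Finset.mem_univ (⟨m, hm'⟩ : Fin n))
      (Finset.mem_univ (⟨m + 1, hm⟩ : Fin n)) (by simp)
    simp only [hdot] at hle
    nlinarith [sq_nonneg (2 * (d ⟨m, hm'⟩ ⬝ᵥ x) + x i), sq_nonneg (x i)]

/-- If `c x_i² ≤ xᵀ V x` for all `x`, with `c > 0`, then `e_iᵀ V⁻¹ e_i ≤ 1 / c`. -/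
lemma inv_diagonal_le_of_le_quadratic_form {ι : Type*} [Fintype ι] [DecidableEq ι]
    {V : Matrix ι ι ℝ} (hV : IsUnit V) {i : ι} {c : ℝ} (hc : 0 < c)
    (hquad : ∀ x : ι → ℝ, c * x i ^ 2 ≤ x ⬝ᵥ (V *ᵥ x)) :
    (Pi.single i 1 : ι → ℝ) ⬝ᵥ (V⁻¹ *ᵥ (Pi.single i 1 : ι → ℝ)) ≤ 1 / c := by
  have hx := hquad (V⁻¹ *ᵥ Pi.single i 1)
  rw [mulVec_mulVec, mul_nonsing_inv V ((isUnit_iff_isUnit_det V).mp hV), one_mulVec,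
    dotProduct_single, mul_one] at hx
  rw [single_dotProduct, one_mul, le_div_iff₀ hc]
  by_contra! hlt
  nlinarith

/-- Fix `K` episodes: for each `k`, a length `t_k` with `0 < t_k ≤ N`
and `{0,1}`-vectors `d_1^k, …, d_{t_k}^k ∈ ℝ^N` with `|supp d_h^k| = h` and nested
supports (here `h : Fin (t k)` is zero-indexed). Let
`V = λI + Σ_k Σ_h d_h^k (d_h^k)ᵀ` and `n_i = #{k : (d_{t_k}^k)_i = 1}`. Then `V` is
invertible and `e_iᵀ V⁻¹ e_i ≤ 4/(n_i + 4λ)` for every `i`. -/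
theorem inverse_quadratic_form_bound_episodes (N K : ℕ) (hN : 0 < N)
    (lam : ℝ) (hlam : 0 < lam)
    (t : Fin K → ℕ) (ht1 : ∀ k, 0 < t k) (ht2 : ∀ k, t k ≤ N)
    (d : (k : Fin K) → Fin (t k) → Fin N → ℝ)
    (h01 : ∀ (k : Fin K) (h : Fin (t k)) (i : Fin N), d k h i = 0 ∨ d k h i = 1)
    (hcard : ∀ (k : Fin K) (h : Fin (t k)),
      (Finset.univ.filter (fun i : Fin N => d k h i = 1)).card = (h : ℕ) + 1)
    (hmono : ∀ (k : Fin K) (h : Fin (t k)) (hlt : (h : ℕ) + 1 < t k) (i : Fin N),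
      d k h i = 1 → d k ⟨(h : ℕ) + 1, hlt⟩ i = 1)
    (V : Matrix (Fin N) (Fin N) ℝ)
    (hV : V = lam • (1 : Matrix (Fin N) (Fin N) ℝ)
        + ∑ k : Fin K, ∑ h : Fin (t k), Matrix.vecMulVec (d k h) (d k h)) :
    IsUnit V ∧
    ∀ i : Fin N,
      (Pi.single i 1 : Fin N → ℝ) ⬝ᵥ (V⁻¹ *ᵥ (Pi.single i 1 : Fin N → ℝ))
        ≤ 4 / (((Finset.univ.filter
            (fun k : Fin K => d k ⟨t k - 1, Nat.sub_lt (ht1 k) one_pos⟩ i = 1)).card : ℝ)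
          + 4 * lam) := by
  have hform : ∀ x : Fin N → ℝ,
      x ⬝ᵥ (V *ᵥ x) = lam * (x ⬝ᵥ x) + ∑ k, ∑ h, (d k h ⬝ᵥ x) ^ 2 := by
    intro x
    simp only [hV, add_mulVec, smul_mulVec, one_mulVec, sum_mulVec, dotProduct_add,
      dotProduct_smul, dotProduct_sum, smul_eq_mul, vecMulVec_mulVec, op_smul_eq_smul]
    simp only [dotProduct_comm x (d _ _), sq]
  have hunit : IsUnit V := by
    rw [← mulVec_injective_iff_isUnit]
    refine (injective_iff_map_eq_zero V.mulVecLin).mpr fun x hx => ?_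
    have hzero := hform x
    rw [← mulVecLin_apply, hx, dotProduct_zero] at hzero
    have hsum : 0 ≤ ∑ k, ∑ h, (d k h ⬝ᵥ x) ^ 2 := by positivity
    have hxx : 0 ≤ x ⬝ᵥ x := Finset.sum_nonneg fun j _ => mul_self_nonneg (x j)
    exact dotProduct_self_eq_zero.mp (by nlinarith)
  refine ⟨hunit, fun i => ?_⟩
  set s := Finset.univ.filter
    (fun k : Fin K => d k ⟨t k - 1, Nat.sub_lt (ht1 k) one_pos⟩ i = 1) with hs
  have hbound := inv_diagonal_le_of_le_quadratic_form hunit (i := i)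
    (c := (s.card : ℝ) / 4 + lam) (by positivity) fun x => by
      have hself : x i ^ 2 ≤ x ⬝ᵥ x := by
        rw [sq]
        exact Finset.single_le_sum (f := fun j => x j * x j)
          (fun j _ => mul_self_nonneg (x j)) (Finset.mem_univ i)
      have hepisodes : s.card * (x i ^ 2 / 4) ≤ ∑ k, ∑ h, (d k h ⬝ᵥ x) ^ 2 := by
        rw [← nsmul_eq_mul]
        refine (Finset.card_nsmul_le_sum s _ _ fun k hk => ?_).trans
          (Finset.sum_le_univ_sum_of_nonneg fun k => by positivity)
        exact sq_div_four_le_sum_sq_dotProduct (d k) (h01 k) (hcard k) (hmono k)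
          ⟨_, (Finset.mem_filter.mp hk).2⟩ x
      rw [hform]
      nlinarith [mul_le_mul_of_nonneg_left hself hlam.le]
  refine hbound.trans_eq ?_
  have : (s.card : ℝ) + 4 * lam ≠ 0 := by positivity
  field_simp
end

section
/- For every vector u ∈ ℝ^N and every index i ∈ {1,…,N}, the i-th coordinate of u satisfies |u_i| ≤ 2·√(uᵀ V u) / √(n_i + 4λ). (This is the deterministic core of the local cost estimation confidence bound: applied to u = ĉ - c, it converts a global design-matrix-norm bound ‖ĉ - c‖_V into a coordinatewise bound that shrinks with the per-coordinate visitation count n_i.) -/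
open Matrix BigOperators

/-- The dot product with a `{0,1}`-valued vector is the sum over its support. -/
lemma dotProduct_eq_sum_filter_of_zero_or_one {ι : Type*} [Fintype ι] (d u : ι → ℝ)
    (h01 : ∀ i, d i = 0 ∨ d i = 1) :
    d ⬝ᵥ u = ∑ i ∈ Finset.univ.filter (fun i => d i = 1), u i := by
  rw [dotProduct, Finset.sum_filter]
  refine Finset.sum_congr rfl fun i _ => ?_
  rcases h01 i with h | h <;> simp [h]

/-- Along a chain of supports growing by one element at a time, the square of every visited
coordinate is controlled by the squares of the partial sums over the supports. -/
lemma sq_coord_le_four_mul_sum_sq_of_chain {ι : Type*} [Fintype ι] {T : ℕ}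
    (d : Fin T → ι → ℝ) (h01 : ∀ h i, d h i = 0 ∨ d h i = 1)
    (hcard : ∀ h : Fin T, (Finset.univ.filter (fun i => d h i = 1)).card = (h : ℕ) + 1)
    (hmono : ∀ (h : Fin T) (hlt : (h : ℕ) + 1 < T) (i : ι),
      d h i = 1 → d ⟨(h : ℕ) + 1, hlt⟩ i = 1)
    (u : ι → ℝ) (i : ι) (h : ℕ) (hT : h < T) (hi : d ⟨h, hT⟩ i = 1) :
    u i ^ 2 ≤ 4 * ∑ h, (d h ⬝ᵥ u) ^ 2 := by
  classical
  have hle (h : Fin T) : (d h ⬝ᵥ u) ^ 2 ≤ ∑ h, (d h ⬝ᵥ u) ^ 2 :=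
    Finset.single_le_sum (f := fun h => (d h ⬝ᵥ u) ^ 2) (fun _ _ => sq_nonneg _)
      (Finset.mem_univ h)
  induction h with
  | zero =>
    obtain ⟨j, hj⟩ := Finset.card_eq_one.mp (hcard ⟨0, hT⟩)
    have hij : i = j := by
      have : i ∈ Finset.univ.filter (fun i => d ⟨0, hT⟩ i = 1) := by simpa using hi
      rwa [hj, Finset.mem_singleton] at this
    have hu : d ⟨0, hT⟩ ⬝ᵥ u = u i := by
      rw [dotProduct_eq_sum_filter_of_zero_or_one _ _ (h01 _), hj, Finset.sum_singleton, hij]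
    have := hle ⟨0, hT⟩
    rw [hu] at this
    nlinarith [sq_nonneg (u i)]
  | succ h ih =>
    have hT' : h < T := by omega
    by_cases hprev : d ⟨h, hT'⟩ i = 1
    · exact ih hT' hprev
    have hnot : i ∉ Finset.univ.filter (fun i => d ⟨h, hT'⟩ i = 1) := by simpa using hprev
    have hins : insert i (Finset.univ.filter (fun i => d ⟨h, hT'⟩ i = 1)) =
        Finset.univ.filter (fun i => d ⟨h + 1, hT⟩ i = 1) := by
      refine Finset.eq_of_subset_of_card_le ?_ ?_
      · intro j hj
        rcases Finset.mem_insert.mp hj with rfl | hj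
        · simpa using hi
        · simpa using hmono ⟨h, hT'⟩ hT j (by simpa using hj)
      · rw [Finset.card_insert_of_notMem hnot, hcard, hcard]
    have hu : d ⟨h + 1, hT⟩ ⬝ᵥ u = u i + d ⟨h, hT'⟩ ⬝ᵥ u := by
      rw [dotProduct_eq_sum_filter_of_zero_or_one _ _ (h01 _),
        dotProduct_eq_sum_filter_of_zero_or_one _ _ (h01 _), ← hins, Finset.sum_insert hnot]
    have h1 := hle ⟨h, hT'⟩
    have h2 := hle ⟨h + 1, hT⟩
    have hui : u i = d ⟨h + 1, hT⟩ ⬝ᵥ u - d ⟨h, hT'⟩ ⬝ᵥ u := by linarith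
    rw [hui]
    nlinarith [sq_nonneg (d ⟨h + 1, hT⟩ ⬝ᵥ u + d ⟨h, hT'⟩ ⬝ᵥ u)]

/-- In the episodic setting of Statement 6 (with
`V = λI + Σ_k Σ_h d_h^k (d_h^k)ᵀ` and `n_i = #{k : (d_{t_k}^k)_i = 1}`), every vector
`u ∈ ℝ^N` satisfies the coordinatewise bound `|u_i| ≤ 2√(uᵀ V u) / √(n_i + 4λ)`. -/
theorem coordinatewise_bound_from_design_norm (N K : ℕ) (hN : 0 < N)
    (lam : ℝ) (hlam : 0 < lam)
    (t : Fin K → ℕ) (ht1 : ∀ k, 0 < t k) (ht2 : ∀ k, t k ≤ N)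
    (d : (k : Fin K) → Fin (t k) → Fin N → ℝ)
    (h01 : ∀ (k : Fin K) (h : Fin (t k)) (i : Fin N), d k h i = 0 ∨ d k h i = 1)
    (hcard : ∀ (k : Fin K) (h : Fin (t k)),
      (Finset.univ.filter (fun i : Fin N => d k h i = 1)).card = (h : ℕ) + 1)
    (hmono : ∀ (k : Fin K) (h : Fin (t k)) (hlt : (h : ℕ) + 1 < t k) (i : Fin N),
      d k h i = 1 → d k ⟨(h : ℕ) + 1, hlt⟩ i = 1)
    (V : Matrix (Fin N) (Fin N) ℝ)
    (hV : V = lam • (1 : Matrix (Fin N) (Fin N) ℝ)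
        + ∑ k : Fin K, ∑ h : Fin (t k), Matrix.vecMulVec (d k h) (d k h)) :
    ∀ (u : Fin N → ℝ) (i : Fin N),
      |u i| ≤ 2 * Real.sqrt (u ⬝ᵥ (V *ᵥ u)) /
        Real.sqrt (((Finset.univ.filter
            (fun k : Fin K => d k ⟨t k - 1, Nat.sub_lt (ht1 k) one_pos⟩ i = 1)).card : ℝ)
          + 4 * lam) := by
  intro u i
  have hquad : u ⬝ᵥ (V *ᵥ u) = lam * ∑ j, u j ^ 2 + ∑ k, ∑ h, (d k h ⬝ᵥ u) ^ 2 := by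
    simp only [hV, add_mulVec, smul_mulVec, one_mulVec, sum_mulVec, vecMulVec_mulVec,
      dotProduct_add, dotProduct_smul, dotProduct_sum, smul_eq_mul, op_smul_eq_smul]
    congr 1
    · simp [dotProduct, sq]
    · simp [dotProduct_comm u, sq]
  have hlow : u i ^ 2 ≤ ∑ j, u j ^ 2 :=
    Finset.single_le_sum (f := fun j => u j ^ 2) (fun _ _ => sq_nonneg _) (Finset.mem_univ i)
  set S := Finset.univ.filter
    (fun k : Fin K => d k ⟨t k - 1, Nat.sub_lt (ht1 k) one_pos⟩ i = 1) with hS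
  have hvisits : S.card * u i ^ 2 ≤ 4 * ∑ k, ∑ h, (d k h ⬝ᵥ u) ^ 2 := by
    calc S.card * u i ^ 2 = ∑ _k ∈ S, u i ^ 2 := by simp
      _ ≤ ∑ k ∈ S, 4 * ∑ h, (d k h ⬝ᵥ u) ^ 2 := by
        refine Finset.sum_le_sum fun k hk => ?_
        exact sq_coord_le_four_mul_sum_sq_of_chain (d k) (h01 k) (hcard k) (hmono k) u i _ _
          (Finset.mem_filter.mp hk).2
      _ ≤ ∑ k, 4 * ∑ h, (d k h ⬝ᵥ u) ^ 2 :=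
        Finset.sum_le_sum_of_subset_of_nonneg (Finset.subset_univ _)
          (fun _ _ _ => by positivity)
      _ = _ := by rw [Finset.mul_sum]
  have hpos : 0 < (S.card : ℝ) + 4 * lam := by positivity
  have hmain : u i ^ 2 * (S.card + 4 * lam) ≤ 2 ^ 2 * (u ⬝ᵥ (V *ᵥ u)) := by
    rw [hquad]
    nlinarith [mul_le_mul_of_nonneg_left hlow hlam.le]
  rw [le_div_iff₀ (Real.sqrt_pos.mpr hpos), ← Real.sqrt_sq_eq_abs,
    ← Real.sqrt_mul (sq_nonneg _)]
  calc √(u i ^ 2 * (S.card + 4 * lam)) ≤ √(2 ^ 2 * (u ⬝ᵥ (V *ᵥ u))) := Real.sqrt_le_sqrt hmain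
    _ = 2 * √(u ⬝ᵥ (V *ᵥ u)) := by
      rw [Real.sqrt_mul (by norm_num), Real.sqrt_sq (by norm_num)]
end

section
/- For every h ∈ {1,…,H+1}, every s₁ ∈ S₁, and all s₂, s̃₂ ∈ S₂ with f(s₂) = f(s̃₂), the optimal values satisfy V_h(s₁, s₂) = V_h(s₁, s̃₂); that is, the optimal value depends on the second state component only through the statistic f. -/
open BigOperators

/-- Two weightings with the same total weight on each fibre of `f` give the same weighted sum of
any function that is constant on the fibres of `f`. -/
lemma sum_mul_eq_sum_mul_of_sum_fiber_eq {ι D R : Type*} [Fintype ι] [DecidableEq D]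
    [NonUnitalNonAssocSemiring R] (f : ι → D) {p q v : ι → R}
    (hv : ∀ i j, f i = f j → v i = v j)
    (hpq : ∀ C, ∑ i with f i = C, p i = ∑ i with f i = C, q i) :
    ∑ i, p i * v i = ∑ i, q i * v i := by
  have hmaps : ∀ i ∈ Finset.univ, f i ∈ Finset.univ.image f :=
    fun i hi => Finset.mem_image_of_mem f hi
  rw [← Finset.sum_fiberwise_of_maps_to hmaps, ← Finset.sum_fiberwise_of_maps_to hmaps]
  refine Finset.sum_congr rfl fun C hC => ?_
  obtain ⟨j, -, rfl⟩ := Finset.mem_image.1 hC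
  have hconst (w : ι → R) :
      ∑ i with f i = f j, w i * v i = (∑ i with f i = f j, w i) * v j := by
    rw [Finset.sum_mul]
    exact Finset.sum_congr rfl fun i hi => by rw [hv i j (Finset.mem_filter.1 hi).2]
  rw [hconst, hconst, hpq]

/-- In a finite-horizon MDP on state space `S₁ × S₂` whose reward
depends only on the `S₁`-component and whose transition kernel satisfies the aggregation
condition with respect to a statistic `f : S₂ → D`, the optimal values (defined by the
backward recursion `V_{H+1} = 0`,
`V_h(s) = max_a [g(s₁,a) + Σ_{s'} P(s'|s,a) V_{h+1}(s')]`) depend on the second state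
component only through `f`: `f(s₂) = f(s̃₂)` implies `V_h(s₁,s₂) = V_h(s₁,s̃₂)`. -/
theorem optimal_value_depends_only_on_statistic
    (S₁ S₂ A : Type*) [Fintype S₁] [Fintype S₂] [Fintype A]
    [Nonempty S₁] [Nonempty S₂] [Nonempty A]
    (D : Type*) [DecidableEq D] (f : S₂ → D) (H : ℕ) (hH : 0 < H)
    (P : S₁ × S₂ → A → S₁ × S₂ → ℝ)
    (hP0 : ∀ s a s', 0 ≤ P s a s') (hP1 : ∀ s a, ∑ s', P s a s' = 1)
    (g : S₁ → A → ℝ)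
    (hagg : ∀ (a : A) (s₁ s₁' : S₁) (C : D) (s₂ t₂ : S₂), f s₂ = f t₂ →
      ∑ σ ∈ Finset.univ.filter (fun σ : S₂ => f σ = C), P (s₁, s₂) a (s₁', σ)
        = ∑ σ ∈ Finset.univ.filter (fun σ : S₂ => f σ = C), P (s₁, t₂) a (s₁', σ))
    (V : ℕ → S₁ × S₂ → ℝ)
    (hVend : ∀ s, V (H + 1) s = 0)
    (hVrec : ∀ h, 1 ≤ h → h ≤ H → ∀ s : S₁ × S₂,
      V h s = Finset.univ.sup' Finset.univ_nonempty
        (fun a : A => g s.1 a + ∑ s', P s a s' * V (h + 1) s')) :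
    ∀ h, 1 ≤ h → h ≤ H + 1 → ∀ (s₁ : S₁) (s₂ t₂ : S₂), f s₂ = f t₂ →
      V h (s₁, s₂) = V h (s₁, t₂) := by
  intro h h1 hH1
  induction hH1 using Nat.decreasingInduction with
  | self => simp [hVend]
  | of_succ h hlt ih =>
    intro s₁ s₂ t₂ hst
    rw [hVrec h h1 (Nat.le_of_lt_succ hlt), hVrec h h1 (Nat.le_of_lt_succ hlt)]
    refine Finset.sup'_congr _ rfl fun a _ => ?_
    rw [Fintype.sum_prod_type, Fintype.sum_prod_type]
    refine congrArg (g s₁ a + ·) (Finset.sum_congr rfl fun s₁' _ => ?_)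
    exact sum_mul_eq_sum_mul_of_sum_fiber_eq f (ih (Nat.le_add_left 1 h) s₁')
      fun C => hagg a s₁ s₁' C s₂ t₂ hst
end

section
/- There exist functions η_h : S₁ → D → A for h = 1,…,H such that the time-dependent deterministic policy π_h(s₁, s₂) = η_h(s₁, f(s₂)) achieves the optimal value everywhere: defining its value by the policy-evaluation recursion W_{H+1}(s) = 0 and W_h(s) = g(s₁, π_h(s)) + Σ_{s'} P(s'|s, π_h(s)) W_{h+1}(s') for 1 ≤ h ≤ H and s = (s₁, s₂), one has W_h(s) = V_h(s) for every h ∈ {1,…,H+1} and every s ∈ S₁ × S₂. That is, a policy depending on the second state component only through f attains the optimal value. -/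
open BigOperators

/-- Under the aggregation condition, the expected next-step value of a function that depends on
the second component only through `f` depends on the current second component only through `f`. -/
lemma sum_kernel_mul_eq_of_statistic_eq {S₁ S₂ A D : Type*} [Fintype S₁] [Fintype S₂]
    [DecidableEq D] {f : S₂ → D} {P : S₁ × S₂ → A → S₁ × S₂ → ℝ}
    (hagg : ∀ (a : A) (s₁ s₁' : S₁) (C : D) (s₂ t₂ : S₂), f s₂ = f t₂ →
      ∑ σ ∈ Finset.univ.filter (fun σ : S₂ => f σ = C), P (s₁, s₂) a (s₁', σ)
        = ∑ σ ∈ Finset.univ.filter (fun σ : S₂ => f σ = C), P (s₁, t₂) a (s₁', σ))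
    {U : S₁ × S₂ → ℝ} (hU : ∀ s₁ s₂ t₂, f s₂ = f t₂ → U (s₁, s₂) = U (s₁, t₂))
    (a : A) (s₁ : S₁) {s₂ t₂ : S₂} (hst : f s₂ = f t₂) :
    ∑ s', P (s₁, s₂) a s' * U s' = ∑ s', P (s₁, t₂) a s' * U s' := by
  rw [Fintype.sum_prod_type, Fintype.sum_prod_type]
  refine Finset.sum_congr rfl fun s₁' _ => ?_
  have hmaps : ∀ σ ∈ (Finset.univ : Finset S₂), f σ ∈ Finset.univ.image f :=
    fun σ hσ => Finset.mem_image_of_mem f hσ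
  rw [← Finset.sum_fiberwise_of_maps_to hmaps, ← Finset.sum_fiberwise_of_maps_to hmaps]
  refine Finset.sum_congr rfl fun C hC => ?_
  obtain ⟨τ, -, rfl⟩ := Finset.mem_image.mp hC
  have hconst : ∀ r₂ : S₂,
      ∑ σ ∈ Finset.univ.filter (fun σ : S₂ => f σ = f τ), P (s₁, r₂) a (s₁', σ) * U (s₁', σ)
        = (∑ σ ∈ Finset.univ.filter (fun σ : S₂ => f σ = f τ), P (s₁, r₂) a (s₁', σ))
          * U (s₁', τ) := by
    intro r₂
    rw [Finset.sum_mul]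
    refine Finset.sum_congr rfl fun σ hσ => ?_
    rw [hU s₁' σ τ (Finset.mem_filter.mp hσ).2]
  rw [hconst, hconst, hagg a s₁ s₁' (f τ) s₂ t₂ hst]

/-- In a finite-horizon MDP on state space `S₁ × S₂` whose reward
depends only on the `S₁`-component and whose transition kernel satisfies the aggregation
condition with respect to a statistic `f : S₂ → D`, there exist functions
`η_h : S₁ → D → A` such that the deterministic policy `π_h(s₁,s₂) = η_h(s₁, f(s₂))`
attains the optimal value: any `W` satisfying the corresponding policy-evaluation
recursion satisfies `W_h = V_h` for all `h ∈ {1,…,H+1}`. -/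
theorem exists_statistic_policy_attaining_optimal_value
    (S₁ S₂ A : Type*) [Fintype S₁] [Fintype S₂] [Fintype A]
    [Nonempty S₁] [Nonempty S₂] [Nonempty A]
    (D : Type*) [DecidableEq D] (f : S₂ → D) (H : ℕ) (hH : 0 < H)
    (P : S₁ × S₂ → A → S₁ × S₂ → ℝ)
    (hP0 : ∀ s a s', 0 ≤ P s a s') (hP1 : ∀ s a, ∑ s', P s a s' = 1)
    (g : S₁ → A → ℝ)
    (hagg : ∀ (a : A) (s₁ s₁' : S₁) (C : D) (s₂ t₂ : S₂), f s₂ = f t₂ →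
      ∑ σ ∈ Finset.univ.filter (fun σ : S₂ => f σ = C), P (s₁, s₂) a (s₁', σ)
        = ∑ σ ∈ Finset.univ.filter (fun σ : S₂ => f σ = C), P (s₁, t₂) a (s₁', σ))
    (V : ℕ → S₁ × S₂ → ℝ)
    (hVend : ∀ s, V (H + 1) s = 0)
    (hVrec : ∀ h, 1 ≤ h → h ≤ H → ∀ s : S₁ × S₂,
      V h s = Finset.univ.sup' Finset.univ_nonempty
        (fun a : A => g s.1 a + ∑ s', P s a s' * V (h + 1) s')) :
    ∃ η : ℕ → S₁ → D → A,
      ∀ W : ℕ → S₁ × S₂ → ℝ,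
        (∀ s, W (H + 1) s = 0) →
        (∀ h, 1 ≤ h → h ≤ H → ∀ s : S₁ × S₂,
          W h s = g s.1 (η h s.1 (f s.2))
            + ∑ s', P s (η h s.1 (f s.2)) s' * W (h + 1) s') →
        ∀ h, 1 ≤ h → h ≤ H + 1 → ∀ s : S₁ × S₂, W h s = V h s := by
  have hVf : ∀ h, 1 ≤ h → h ≤ H + 1 → ∀ s₁ s₂ t₂, f s₂ = f t₂ → V h (s₁, s₂) = V h (s₁, t₂) := by
    intro h h1 hle
    induction hle using Nat.decreasingInduction with
    | self => intro s₁ s₂ t₂ _; rw [hVend, hVend]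
    | of_succ h hlt ih =>
      intro s₁ s₂ t₂ hst
      rw [hVrec h h1 (Nat.lt_succ_iff.mp hlt), hVrec h h1 (Nat.lt_succ_iff.mp hlt)]
      simp only [sum_kernel_mul_eq_of_statistic_eq hagg (ih (Nat.le_add_left 1 h)) _ s₁ hst]
  have hη : ∀ (h : ℕ) (s₁ : S₁) (d : D), ∃ a : A, 1 ≤ h → h ≤ H → ∀ s₂, f s₂ = d →
      V h (s₁, s₂) = g s₁ a + ∑ s', P (s₁, s₂) a s' * V (h + 1) s' := by
    intro h s₁ d
    by_cases hd : ∃ t₂, f t₂ = d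
    · obtain ⟨t₂, rfl⟩ := hd
      obtain ⟨a, -, ha⟩ := Finset.exists_mem_eq_sup' Finset.univ_nonempty
        (fun a : A => g s₁ a + ∑ s', P (s₁, t₂) a s' * V (h + 1) s')
      refine ⟨a, fun h1 hle s₂ hst => ?_⟩
      rw [hVf h h1 (Nat.le_succ_of_le hle) s₁ s₂ t₂ hst, hVrec h h1 hle, ha,
        sum_kernel_mul_eq_of_statistic_eq hagg
          (hVf (h + 1) (Nat.le_add_left 1 h) (Nat.succ_le_succ hle)) a s₁ hst]
    · exact ⟨Classical.arbitrary A, fun _ _ s₂ hs => (hd ⟨s₂, hs⟩).elim⟩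
  choose η hη using hη
  refine ⟨η, fun W hWend hWrec h h1 hle => ?_⟩
  induction hle using Nat.decreasingInduction with
  | self => intro s; rw [hWend, hVend]
  | of_succ h hlt ih =>
    intro s
    have hle : h ≤ H := Nat.lt_succ_iff.mp hlt
    rw [hWrec h h1 hle, hη h s.1 (f s.2) h1 hle s.2 rfl]
    simp only [ih (Nat.le_add_left 1 h)]
end

section
/- The Termination Bellman Equations hold: for every 1 ≤ h < H, every s ∈ S, C ∈ ℝ, and a ∈ A, Q_h(s, C, a) = r(s, a) + (1 - ρ(C - b)) · Σ_{s' ∈ S} P(s'|s,a) Σ_{a' ∈ A} π(a'|s') Q_{h+1}(s', C + c(s', a'), a'), and Q_H(s, C, a) = r(s, a). -/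
open BigOperators

/-- The logistic function `ρ(z) = 1/(1 + exp(-z))`. -/
noncomputable def logistic (z : ℝ) : ℝ := 1 / (1 + Real.exp (-z))

/-- The cost-augmented state-action value as an explicit finite expectation.
`termQ P pol r c b m s C a` is the sum over sequences
`(s_1, a_1, …, s_m, a_m) ∈ (S × A)^m` (the states and actions following the current
state-action pair `(s, a)`, so `m = H - h`) of the path probability
`Π_j P(s_j | s_{j-1}, a_{j-1})·π(a_j | s_j)` times the dynamically discounted return
`Σ_{t=0}^m (Π_{j=1}^t γ_j) r(s_t, a_t)`, where `(s_0, a_0) = (s, a)`, the accumulated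
costs are `C_0 = C`, `C_j = C_{j-1} + c(s_j, a_j)`, and the discounts are
`γ_j = 1 - ρ(C_{j-1} - b)`. -/
noncomputable def termQ {S A : Type*} [Fintype S] [Fintype A]
    (P : S → A → S → ℝ) (pol : S → A → ℝ) (r : S → A → ℝ) (c : S → A → ℝ)
    (b : ℝ) (m : ℕ) (s : S) (C : ℝ) (a : A) : ℝ :=
  ∑ w : Fin m → S × A,
    (∏ j : Fin m,
      P (if _h0 : (j : ℕ) = 0 then (s, a) else
            w ⟨(j : ℕ) - 1, Nat.lt_of_le_of_lt (Nat.sub_le _ 1) j.isLt⟩).1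
        (if _h0 : (j : ℕ) = 0 then (s, a) else
            w ⟨(j : ℕ) - 1, Nat.lt_of_le_of_lt (Nat.sub_le _ 1) j.isLt⟩).2
        (w j).1
      * pol (w j).1 (w j).2)
    *
    ∑ t : Fin (m + 1),
      (∏ j ∈ Finset.range (t : ℕ),
        (1 - logistic
          (C + (∑ u ∈ Finset.univ.filter (fun u : Fin m => (u : ℕ) < j),
              c (w u).1 (w u).2) - b)))
      *
      r (if _h0 : (t : ℕ) = 0 then (s, a) else
            w ⟨(t : ℕ) - 1, by have := t.isLt; omega⟩).1
        (if _h0 : (t : ℕ) = 0 then (s, a) else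
            w ⟨(t : ℕ) - 1, by have := t.isLt; omega⟩).2

/-- The probability of the trajectory `w` started from the state-action pair `p`. -/
noncomputable def pathProb {S A : Type*} (P : S → A → S → ℝ) (pol : S → A → ℝ)
    (m : ℕ) (p : S × A) (w : Fin m → S × A) : ℝ :=
  ∏ j : Fin m,
    P (Fin.cons (α := fun _ => S × A) p w j.castSucc).1
      (Fin.cons (α := fun _ => S × A) p w j.castSucc).2 (w j).1 * pol (w j).1 (w j).2

/-- The dynamically discounted return along the trajectory `w` started from `p`. -/
noncomputable def pathReturn {S A : Type*} (r c : S → A → ℝ) (b : ℝ)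
    (m : ℕ) (p : S × A) (C : ℝ) (w : Fin m → S × A) : ℝ :=
  ∑ t : Fin (m + 1),
    (∏ j ∈ Finset.range (t : ℕ),
      (1 - logistic
        (C + (∑ u ∈ Finset.univ.filter (fun u : Fin m => (u : ℕ) < j),
            c (w u).1 (w u).2) - b)))
    * r (Fin.cons (α := fun _ => S × A) p w t).1 (Fin.cons (α := fun _ => S × A) p w t).2

theorem dite_pred_eq_cons {α : Type*} {m : ℕ} (p : α) (w : Fin m → α) (t : Fin (m + 1))
    (h : ¬ (t : ℕ) = 0 → (t : ℕ) - 1 < m) :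
    (if h0 : (t : ℕ) = 0 then p else w ⟨(t : ℕ) - 1, h h0⟩) =
      Fin.cons (α := fun _ => α) p w t := by
  cases t using Fin.cases <;> simp

theorem termQ_eq_sum_pathProb_mul_pathReturn {S A : Type*} [Fintype S] [Fintype A]
    (P : S → A → S → ℝ) (pol r c : S → A → ℝ) (b : ℝ) (m : ℕ) (s : S) (C : ℝ) (a : A) :
    termQ P pol r c b m s C a =
      ∑ w : Fin m → S × A, pathProb P pol m (s, a) w * pathReturn r c b m (s, a) C w := by
  unfold termQ pathProb pathReturn
  refine Finset.sum_congr rfl fun w _ => ?_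
  congr 1
  · refine Finset.prod_congr rfl fun j _ => ?_
    rw [← dite_pred_eq_cons (s, a) w j.castSucc (fun _ => by have := j.isLt; simp; omega)]
    rfl
  · refine Finset.sum_congr rfl fun t _ => ?_
    rw [← dite_pred_eq_cons (s, a) w t (fun _ => by have := t.isLt; omega)]

theorem pathProb_cons {S A : Type*} (P : S → A → S → ℝ) (pol : S → A → ℝ)
    (m : ℕ) (p q : S × A) (w : Fin m → S × A) :
    pathProb P pol (m + 1) p (Fin.cons (α := fun _ => S × A) q w) =
      P p.1 p.2 q.1 * pol q.1 q.2 * pathProb P pol m q w := by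
  unfold pathProb
  rw [Fin.prod_univ_succ]
  simp

theorem sum_filter_cons_lt_succ {α : Type*} (f : α → ℝ) (m j : ℕ) (q : α) (w : Fin m → α) :
    ∑ u ∈ Finset.univ.filter (fun u : Fin (m + 1) => (u : ℕ) < j + 1),
        f (Fin.cons (α := fun _ => α) q w u) =
      f q + ∑ u ∈ Finset.univ.filter (fun u : Fin m => (u : ℕ) < j), f (w u) := by
  simp [Finset.sum_filter, Fin.sum_univ_succ]

theorem pathReturn_cons {S A : Type*} (r c : S → A → ℝ) (b : ℝ)
    (m : ℕ) (p q : S × A) (C : ℝ) (w : Fin m → S × A) :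
    pathReturn r c b (m + 1) p C (Fin.cons (α := fun _ => S × A) q w) =
      r p.1 p.2 + (1 - logistic (C - b)) * pathReturn r c b m q (C + c q.1 q.2) w := by
  unfold pathReturn
  rw [Fin.sum_univ_succ, Finset.mul_sum]
  congr 1
  · simp
  · refine Finset.sum_congr rfl fun t _ => ?_
    rw [Fin.val_succ, Finset.prod_range_succ', Fin.cons_succ, ← mul_assoc]
    congr 1
    rw [mul_comm]
    congr 1
    · simp
    · refine Finset.prod_congr rfl fun j _ => ?_
      rw [sum_filter_cons_lt_succ (fun x : S × A => c x.1 x.2), add_assoc]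

theorem sum_fin_succ_fun {α : Type*} [Fintype α] (m : ℕ) (f : (Fin (m + 1) → α) → ℝ) :
    ∑ w, f w = ∑ q : α, ∑ w : Fin m → α, f (Fin.cons (α := fun _ => α) q w) := by
  rw [← Fintype.sum_prod_type' (f := fun q w => f (Fin.cons (α := fun _ => α) q w))]
  exact (Fintype.sum_equiv (Fin.consEquiv fun _ => α) _ _ fun _ => rfl).symm

theorem sum_step_eq_one {S A : Type*} [Fintype S] [Fintype A]
    {P : S → A → S → ℝ} (hP1 : ∀ s a, ∑ s', P s a s' = 1)
    {pol : S → A → ℝ} (hpol1 : ∀ s, ∑ a, pol s a = 1) (p : S × A) :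
    ∑ q : S × A, P p.1 p.2 q.1 * pol q.1 q.2 = 1 := by
  simp [Fintype.sum_prod_type, ← Finset.mul_sum, hpol1, hP1]

theorem sum_pathProb {S A : Type*} [Fintype S] [Fintype A]
    {P : S → A → S → ℝ} (hP1 : ∀ s a, ∑ s', P s a s' = 1)
    {pol : S → A → ℝ} (hpol1 : ∀ s, ∑ a, pol s a = 1) (m : ℕ) (p : S × A) :
    ∑ w, pathProb P pol m p w = 1 := by
  induction m generalizing p with
  | zero => simp [pathProb]
  | succ m ih =>
    simp [sum_fin_succ_fun, pathProb_cons, ← Finset.mul_sum, ih, sum_step_eq_one hP1 hpol1]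

theorem termQ_zero {S A : Type*} [Fintype S] [Fintype A]
    (P : S → A → S → ℝ) (pol r c : S → A → ℝ) (b : ℝ) (s : S) (C : ℝ) (a : A) :
    termQ P pol r c b 0 s C a = r s a := by
  simp [termQ]

theorem termQ_succ {S A : Type*} [Fintype S] [Fintype A]
    {P : S → A → S → ℝ} (hP1 : ∀ s a, ∑ s', P s a s' = 1)
    {pol : S → A → ℝ} (hpol1 : ∀ s, ∑ a, pol s a = 1)
    (r c : S → A → ℝ) (b : ℝ) (m : ℕ) (s : S) (C : ℝ) (a : A) :
    termQ P pol r c b (m + 1) s C a = r s a + (1 - logistic (C - b)) *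
      ∑ s' : S, P s a s' * ∑ a' : A, pol s' a' * termQ P pol r c b m s' (C + c s' a') a' := by
  have step (q : S × A) :
      ∑ w : Fin m → S × A, pathProb P pol (m + 1) (s, a) (Fin.cons (α := fun _ => S × A) q w) *
          pathReturn r c b (m + 1) (s, a) C (Fin.cons (α := fun _ => S × A) q w) =
        P s a q.1 * pol q.1 q.2 * r s a + (1 - logistic (C - b)) *
          (P s a q.1 * (pol q.1 q.2 * termQ P pol r c b m q.1 (C + c q.1 q.2) q.2)) := by
    calc
      _ = ∑ w : Fin m → S × A, (P s a q.1 * pol q.1 q.2 * r s a * pathProb P pol m q w +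
            (1 - logistic (C - b)) * (P s a q.1 * (pol q.1 q.2 *
              (pathProb P pol m q w * pathReturn r c b m q (C + c q.1 q.2) w)))) := by
        refine Finset.sum_congr rfl fun w _ => ?_
        rw [pathProb_cons, pathReturn_cons]
        ring
      _ = _ := by
        simp only [Finset.sum_add_distrib, ← Finset.mul_sum, sum_pathProb hP1 hpol1, mul_one,
          termQ_eq_sum_pathProb_mul_pathReturn]
  rw [termQ_eq_sum_pathProb_mul_pathReturn, sum_fin_succ_fun, Finset.sum_congr rfl fun q _ => step q,
    Finset.sum_add_distrib, ← Finset.sum_mul, sum_step_eq_one hP1 hpol1 (s, a), one_mul,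
    ← Finset.mul_sum, Fintype.sum_prod_type]
  simp only [Finset.mul_sum]

/-- The Termination Bellman Equations: with
`Q_h(s, C, a) = termQ P π r c b (H - h) s C a` the explicit finite-horizon expectation
of the dynamically discounted return, for every `1 ≤ h < H`,
`Q_h(s,C,a) = r(s,a) + (1 - ρ(C - b)) Σ_{s'} P(s'|s,a) Σ_{a'} π(a'|s') Q_{h+1}(s', C + c(s',a'), a')`,
and `Q_H(s,C,a) = r(s,a)`. -/
theorem termination_bellman_equations
    (S A : Type*) [Fintype S] [Fintype A] [Nonempty S] [Nonempty A]
    (H : ℕ) (hH : 0 < H)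
    (P : S → A → S → ℝ) (hP0 : ∀ s a s', 0 ≤ P s a s') (hP1 : ∀ s a, ∑ s', P s a s' = 1)
    (pol : S → A → ℝ) (hpol0 : ∀ s a, 0 ≤ pol s a) (hpol1 : ∀ s, ∑ a, pol s a = 1)
    (r : S → A → ℝ) (c : S → A → ℝ) (b : ℝ)
    (Q : ℕ → S → ℝ → A → ℝ)
    (hQ : ∀ h, 1 ≤ h → h ≤ H → ∀ (s : S) (C : ℝ) (a : A),
      Q h s C a = termQ P pol r c b (H - h) s C a) :
    (∀ h, 1 ≤ h → h < H → ∀ (s : S) (C : ℝ) (a : A),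
      Q h s C a = r s a + (1 - logistic (C - b)) *
        ∑ s' : S, P s a s' * ∑ a' : A, pol s' a' * Q (h + 1) s' (C + c s' a') a')
    ∧ (∀ (s : S) (C : ℝ) (a : A), Q H s C a = r s a) := by
  refine ⟨fun h h1 hlt s C a => ?_, fun s C a => ?_⟩
  · rw [hQ h h1 hlt.le, show H - h = H - (h + 1) + 1 by omega, termQ_succ hP1 hpol1]
    simp only [hQ (h + 1) (by omega) hlt]
  · rw [hQ H hH le_rfl, Nat.sub_self, termQ_zero]
end
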